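/- Let q0, qx, qy, qxy ∈ ℝ² and define the vertex family v(i,j) = q0 + i·qx + j·qy + (i·j)·qxy. For integers i,j let r_{ij} : [-1,1]² → ℝ² be the bilinear map r_{ij}(ξ,η) = v(i,j)·Φ₋₁,₋₁(ξ,η) + v(i+1,j)·Φ₁,₋₁(ξ,η) + v(i+1,j+1)·Φ₁,₁(ξ,η) + v(i,j+1)·Φ₋₁,₁(ξ,η), with Jacobian matrix J^{(i,j)}(ξ,η). Then the Jacobian determinant is an affine function of the element index (i,j): for all integers i,j and all (ξ,η), det J^{(i,j)}(ξ,η) = det J^{(0,0)}(ξ,η) + i·(det J^{(1,0)}(ξ,η) − det J^{(0,0)}(ξ,η)) + j·(det J^{(0,1)}(ξ,η) − det J^{(0,0)}(ξ,η)). -/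

import Mathlib

noncomputable section

/-- Bilinear Lagrange shape function on `[-1,1]²` associated with corner `(sx, sy)`,
where `sx, sy ∈ {-1, 1}`:  `Φ_{sx,sy}(ξ,η) = (1 + sx·ξ)(1 + sy·η)/4`. -/
def Phi (sx sy ξ η : ℝ) : ℝ := (1 + sx * ξ) * (1 + sy * η) / 4

/-- The vertex family `v(i,j) = q0 + i·qx + j·qy + (i·j)·qxy`. -/
def vtx (q0 qx qy qxy : Fin 2 → ℝ) (i j : ℝ) : Fin 2 → ℝ :=
  q0 + i • qx + j • qy + (i * j) • qxy

/-- The bilinear map `r_{ij}(ξ,η)` interpolating the four vertices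
`v(i,j), v(i+1,j), v(i+1,j+1), v(i,j+1)` with the shape functions. -/
def rmap (q0 qx qy qxy : Fin 2 → ℝ) (i j : ℤ) (ξ η : ℝ) : Fin 2 → ℝ :=
  Phi (-1) (-1) ξ η • vtx q0 qx qy qxy (i : ℝ) (j : ℝ)
    + Phi 1 (-1) ξ η • vtx q0 qx qy qxy ((i : ℝ) + 1) (j : ℝ)
    + Phi 1 1 ξ η • vtx q0 qx qy qxy ((i : ℝ) + 1) ((j : ℝ) + 1)
    + Phi (-1) 1 ξ η • vtx q0 qx qy qxy (i : ℝ) ((j : ℝ) + 1)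

/-- The `2×2` Jacobian matrix of `r_{ij}` at `(ξ,η)`: first column is the partial
derivative with respect to `ξ`, second column with respect to `η`. -/
def Jac (q0 qx qy qxy : Fin 2 → ℝ) (i j : ℤ) (ξ η : ℝ) : Matrix (Fin 2) (Fin 2) ℝ :=
  Matrix.of fun a b : Fin 2 =>
    if b = 0 then deriv (fun t => rmap q0 qx qy qxy i j t η a) ξ
    else deriv (fun t => rmap q0 qx qy qxy i j ξ t a) η


/-- The bilinear map is the vertex family evaluated at a shifted fractional index. -/
theorem rmap_eq_vtx (q0 qx qy qxy : Fin 2 → ℝ) (i j : ℤ) (ξ η : ℝ) :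
    rmap q0 qx qy qxy i j ξ η = vtx q0 qx qy qxy (i + (1 + ξ) / 2) (j + (1 + η) / 2) := by
  ext a
  simp only [rmap, vtx, Phi, Pi.add_apply, Pi.smul_apply, smul_eq_mul]
  ring

theorem hasDerivAt_rmap_left (q0 qx qy qxy : Fin 2 → ℝ) (i j : ℤ) (ξ η : ℝ) (a : Fin 2) :
    HasDerivAt (fun t => rmap q0 qx qy qxy i j t η a)
      ((qx a + (j + (1 + η) / 2) * qxy a) / 2) ξ := by
  have h := ((hasDerivAt_id ξ).mul_const ((qx a + (j + (1 + η) / 2) * qxy a) / 2)).add_const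
    (rmap q0 qx qy qxy i j 0 η a)
  rw [one_mul] at h
  refine h.congr_of_eventuallyEq (Filter.Eventually.of_forall fun t => ?_)
  simp only [rmap_eq_vtx, vtx, Pi.add_apply, Pi.smul_apply, smul_eq_mul, id_eq]
  ring

theorem hasDerivAt_rmap_right (q0 qx qy qxy : Fin 2 → ℝ) (i j : ℤ) (ξ η : ℝ) (a : Fin 2) :
    HasDerivAt (fun t => rmap q0 qx qy qxy i j ξ t a)
      ((qy a + (i + (1 + ξ) / 2) * qxy a) / 2) η := by
  have h := ((hasDerivAt_id η).mul_const ((qy a + (i + (1 + ξ) / 2) * qxy a) / 2)).add_const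
    (rmap q0 qx qy qxy i j ξ 0 a)
  rw [one_mul] at h
  refine h.congr_of_eventuallyEq (Filter.Eventually.of_forall fun t => ?_)
  simp only [rmap_eq_vtx, vtx, Pi.add_apply, Pi.smul_apply, smul_eq_mul, id_eq]
  ring

theorem det_Jac (q0 qx qy qxy : Fin 2 → ℝ) (i j : ℤ) (ξ η : ℝ) :
    (Jac q0 qx qy qxy i j ξ η).det =
      ((qx 0 * qy 1 - qx 1 * qy 0) + (i + (1 + ξ) / 2) * (qx 0 * qxy 1 - qx 1 * qxy 0)
        + (j + (1 + η) / 2) * (qxy 0 * qy 1 - qxy 1 * qy 0)) / 4 := by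
  simp only [Matrix.det_fin_two, Jac, Matrix.of_apply, if_true, one_ne_zero, if_false,
    (hasDerivAt_rmap_left q0 qx qy qxy i j ξ η _).deriv,
    (hasDerivAt_rmap_right q0 qx qy qxy i j ξ η _).deriv]
  ring

/-- The Jacobian determinant is an affine function of the element index `(i,j)`. -/
theorem jacobian_det_affine_in_index (q0 qx qy qxy : Fin 2 → ℝ) (i j : ℤ) (ξ η : ℝ) :
    (Jac q0 qx qy qxy i j ξ η).det =
      (Jac q0 qx qy qxy 0 0 ξ η).det
        + (i : ℝ) * ((Jac q0 qx qy qxy 1 0 ξ η).det - (Jac q0 qx qy qxy 0 0 ξ η).det)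
        + (j : ℝ) * ((Jac q0 qx qy qxy 0 1 ξ η).det - (Jac q0 qx qy qxy 0 0 ξ η).det) := by
  simp only [det_Jac, Int.cast_zero, Int.cast_one]
  ring

end
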